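/- Let G be a finite abelian group and let S be a sequence over G with |S| ≥ D(G) − 1. If N_h(S) = 2^{|S|−D(G)+1} for some h ∈ G, then N_g(S) ≥ 2^{|S|−D(G)+1} for every g ∈ G. -/

import Mathlib

/-- `NSub S g` is the number of subsequences (sub-multisets, counted with the
multiplicity of their appearance in `S`) of the sequence `S` with sum `g`. -/
def NSub {G : Type*} [AddCommGroup G] [DecidableEq G] (S : Multiset G) (g : G) : ℕ :=
  (S.powerset.filter (fun T => T.sum = g)).card

/-- The Davenport constant of `G`: the smallest positive integer `ℓ` such that every
sequence over `G` of length at least `ℓ` has a nonempty zero-sum subsequence. -/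
noncomputable def Davenport (G : Type*) [AddCommGroup G] : ℕ :=
  sInf {ℓ : ℕ | 0 < ℓ ∧ ∀ S : Multiset G, ℓ ≤ Multiset.card S →
    ∃ T : Multiset G, T ≤ S ∧ T ≠ 0 ∧ T.sum = 0}

/-- `ESet S = {g ∈ G : N_g(S) = 2 ^ (|S| - D(G) + 1)}`. -/
def ESet {G : Type*} [AddCommGroup G] [DecidableEq G] (S : Multiset G) : Set G :=
  {g | NSub S g = 2 ^ (Multiset.card S + 1 - Davenport G)}

/-- A minimal zero-sum sequence: nonempty, zero-sum, and every nonempty proper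
subsequence has nonzero sum. -/
def IsMinZeroSum {G : Type*} [AddCommGroup G] (T : Multiset G) : Prop :=
  T ≠ 0 ∧ T.sum = 0 ∧ ∀ U : Multiset G, U ≤ T → U ≠ 0 → U ≠ T → U.sum ≠ 0

/-- Every sufficiently long sequence over a finite abelian group has a nonempty zero-sum
subsequence, since some element is repeated at least `|G|` times. -/
theorem exists_zeroSum_of_sq_card_le {G : Type*} [AddCommGroup G] [Fintype G]
    (S : Multiset G) (hS : Fintype.card G * Fintype.card G ≤ Multiset.card S) :
    ∃ T : Multiset G, T ≤ S ∧ T ≠ 0 ∧ T.sum = 0 := by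
  classical
  obtain ⟨a, ha⟩ : ∃ a, Fintype.card G ≤ S.count a := by
    by_contra! hlt
    have hcard : ∑ a : G, S.count a = Multiset.card S :=
      Multiset.sum_count_eq_card fun a _ => Finset.mem_univ a
    have hsum : ∑ a : G, S.count a < ∑ _a : G, Fintype.card G :=
      Finset.sum_lt_sum_of_nonempty Finset.univ_nonempty fun a _ => hlt a
    simp only [Finset.sum_const, Finset.card_univ, smul_eq_mul] at hsum
    omega
  refine ⟨Multiset.replicate (Fintype.card G) a, Multiset.le_count_iff_replicate_le.mp ha, ?_, ?_⟩
  · intro h0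
    have := congrArg Multiset.card h0
    simp at this
  · simp

theorem Davenport_spec (G : Type*) [AddCommGroup G] [Fintype G] :
    0 < Davenport G ∧ ∀ S : Multiset G, Davenport G ≤ Multiset.card S →
      ∃ T : Multiset G, T ≤ S ∧ T ≠ 0 ∧ T.sum = 0 :=
  Nat.sInf_mem (s := {ℓ : ℕ | 0 < ℓ ∧ ∀ S : Multiset G, ℓ ≤ Multiset.card S →
    ∃ T : Multiset G, T ≤ S ∧ T ≠ 0 ∧ T.sum = 0})
    ⟨Fintype.card G * Fintype.card G, Nat.mul_pos Fintype.card_pos Fintype.card_pos,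
      exists_zeroSum_of_sq_card_le⟩

section

variable {G : Type*} [AddCommGroup G] [DecidableEq G]

theorem NSub_cons (a : G) (S : Multiset G) (g : G) :
    NSub (a ::ₘ S) g = NSub S g + NSub S (g - a) := by
  simp [NSub, Multiset.powerset_cons, Multiset.filter_map,
    eq_sub_iff_add_eq']

theorem NSub_pos_iff {S : Multiset G} {g : G} :
    0 < NSub S g ↔ ∃ T, T ≤ S ∧ T.sum = g := by
  simp [NSub, Multiset.card_pos_iff_exists_mem]

/-- A subsequence of the sequence obtained from `S` by negating the terms of `T`. -/
theorem exists_eq_add_map_neg {S T U : Multiset G} (hU : U ≤ (S - T) + T.map Neg.neg) :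
    ∃ A B : Multiset G, A ≤ T ∧ B ≤ S - T ∧ U = B + A.map Neg.neg := by
  refine ⟨(U - (S - T)).map Neg.neg, U ∩ (S - T), ?_, Multiset.inter_le_right, ?_⟩
  · have := Multiset.map_le_map (f := Neg.neg) (tsub_le_iff_left.mpr hU)
    simpa using this
  · ext x
    simp [Multiset.count_inter]
    omega

/-- If `T` is a subsequence of `S` with sum `h` and negating the terms of `T` produces a
nonempty zero-sum subsequence, then some term of `S` can be both used and avoided when
representing `h`. -/
theorem exists_mem_NSub_erase_pos {S T U : Multiset G} (hT : T ≤ S)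
    (hU : U ≤ (S - T) + T.map Neg.neg) (hU0 : U ≠ 0) (hUs : U.sum = 0) :
    ∃ a ∈ S, 0 < NSub (S.erase a) T.sum ∧ 0 < NSub (S.erase a) (T.sum - a) := by
  obtain ⟨A, B, hA, hB, rfl⟩ := exists_eq_add_map_neg hU
  have hBA : B.sum = A.sum := by
    rw [Multiset.sum_add, Multiset.sum_map_neg'] at hUs
    exact add_neg_eq_zero.mp hUs
  obtain ⟨C, rfl⟩ := Multiset.le_iff_exists_add.mp hA
  obtain ⟨R, rfl⟩ := Multiset.le_iff_exists_add.mp hT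
  rw [add_tsub_cancel_left] at hB
  obtain ⟨E, rfl⟩ := Multiset.le_iff_exists_add.mp hB
  simp only [NSub_pos_iff]
  rcases Multiset.empty_or_exists_mem B with rfl | ⟨a, ha⟩
  · rcases Multiset.empty_or_exists_mem A with rfl | ⟨a, ha⟩
    · simp at hU0
    · obtain ⟨A, rfl⟩ := Multiset.exists_cons_of_mem ha
      refine ⟨a, by simp, ⟨C, ?_, ?_⟩, ⟨A + C, ?_, ?_⟩⟩
      · simp only [Multiset.cons_add, Multiset.erase_cons_head, Multiset.le_iff_count,
          Multiset.count_add]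
        intro x; omega
      · rw [Multiset.sum_add, ← hBA]; simp
      · simp
      · simp
  · obtain ⟨B, rfl⟩ := Multiset.exists_cons_of_mem ha
    have hS : A + C + (a ::ₘ B + E) = a ::ₘ (A + C + (B + E)) := by simp
    rw [hS]
    refine ⟨a, by simp, ⟨A + C, ?_, rfl⟩, ⟨B + C, ?_, ?_⟩⟩
    · simp
    · simp only [Multiset.erase_cons_head, Multiset.le_iff_count, Multiset.count_add]
      intro x; omega
    · rw [Multiset.sum_add, Multiset.sum_add, ← hBA, Multiset.sum_cons]; abel

variable [Fintype G]

theorem exists_cons_of_Davenport_le {S : Multiset G} (hS : Davenport G ≤ Multiset.card S) {h : G}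
    (hh : 0 < NSub S h) :
    ∃ a R, S = a ::ₘ R ∧ 0 < NSub R h ∧ 0 < NSub R (h - a) := by
  obtain ⟨T, hT, rfl⟩ := NSub_pos_iff.mp hh
  obtain ⟨U, hU, hU0, hUs⟩ := (Davenport_spec G).2 ((S - T) + T.map Neg.neg) (by
    rw [Multiset.card_add, Multiset.card_map, ← Multiset.card_add, tsub_add_cancel_of_le hT]
    exact hS)
  obtain ⟨a, ha, h1, h2⟩ := exists_mem_NSub_erase_pos hT hU hU0 hUs
  exact ⟨a, S.erase a, (Multiset.cons_erase ha).symm, h1, h2⟩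

/-- Every represented element is represented at least `2 ^ (|S| - D(G) + 1)` times. -/
theorem two_pow_le_NSub {n : ℕ} {S : Multiset G} (hS : Multiset.card S + 1 = Davenport G + n)
    {g : G} (hg : 0 < NSub S g) : 2 ^ n ≤ NSub S g := by
  induction n generalizing S g with
  | zero => exact hg
  | succ n ih =>
    obtain ⟨a, R, rfl, h1, h2⟩ := exists_cons_of_Davenport_le (by omega) hg
    rw [Multiset.card_cons] at hS
    have h1 := ih (by omega) h1
    have h2 := ih (by omega) h2
    rw [NSub_cons, pow_succ]
    omega

/-- If `|S| = D(G) - 1` and some element is represented exactly once, then every element is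
represented. -/
theorem NSub_pos_of_NSub_eq_one {S : Multiset G} (hS : Multiset.card S + 1 = Davenport G) {h : G}
    (hh : NSub S h = 1) (g : G) : 0 < NSub S g := by
  obtain ⟨T, hT, rfl⟩ := NSub_pos_iff.mp (hh ▸ one_pos)
  obtain ⟨U, hU, hU0, hUs⟩ := (Davenport_spec G).2 ((T.sum - g) ::ₘ ((S - T) + T.map Neg.neg)) (by
    rw [Multiset.card_cons, Multiset.card_add, Multiset.card_map, ← Multiset.card_add,
      tsub_add_cancel_of_le hT]
    exact hS.ge)
  by_cases hU' : U ≤ (S - T) + T.map Neg.neg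
  · obtain ⟨a, ha, h1, h2⟩ := exists_mem_NSub_erase_pos hT hU' hU0 hUs
    rw [← Multiset.cons_erase ha, NSub_cons] at hh
    omega
  · have hmem : T.sum - g ∈ U := by
      by_contra hn
      exact hU' ((Multiset.le_cons_of_notMem hn).mp hU)
    obtain ⟨V, rfl⟩ := Multiset.exists_cons_of_mem hmem
    obtain ⟨A, B, hA, hB, rfl⟩ := exists_eq_add_map_neg ((Multiset.cons_le_cons_iff _).mp hU)
    obtain ⟨C, rfl⟩ := Multiset.le_iff_exists_add.mp hA
    refine NSub_pos_iff.mpr ⟨C + B, ?_, ?_⟩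
    · calc C + B ≤ (A + C) + (S - (A + C)) := add_le_add (Multiset.le_add_left _ _) hB
        _ = S := add_tsub_cancel_of_le hT
    · rw [Multiset.sum_cons, Multiset.sum_add, Multiset.sum_add, Multiset.sum_map_neg'] at hUs
      rw [Multiset.sum_add, ← sub_eq_zero, ← hUs]
      abel

theorem two_pow_le_NSub_of_eq {n : ℕ} {S : Multiset G}
    (hS : Multiset.card S + 1 = Davenport G + n) {h : G} (hh : NSub S h = 2 ^ n) (g : G) :
    2 ^ n ≤ NSub S g := by
  induction n generalizing S h g with
  | zero => exact NSub_pos_of_NSub_eq_one hS hh g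
  | succ n ih =>
    obtain ⟨a, R, rfl, h1, h2⟩ :=
      exists_cons_of_Davenport_le (h := h) (by omega) (hh ▸ Nat.two_pow_pos _)
    rw [Multiset.card_cons] at hS
    have hR : Multiset.card R + 1 = Davenport G + n := by omega
    have h1 := two_pow_le_NSub hR h1
    have h2 := two_pow_le_NSub hR h2
    rw [NSub_cons, pow_succ] at hh
    have hRh : NSub R h = 2 ^ n := by omega
    have h3 := ih hR hRh g
    have h4 := ih hR hRh (g - a)
    rw [NSub_cons, pow_succ]
    omega

end

theorem stmt3 {G : Type*} [AddCommGroup G] [Fintype G] [DecidableEq G]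
    (S : Multiset G) (hlen : Davenport G - 1 ≤ Multiset.card S)
    (h : G) (hh : NSub S h = 2 ^ (Multiset.card S + 1 - Davenport G)) :
    ∀ g : G, 2 ^ (Multiset.card S + 1 - Davenport G) ≤ NSub S g := by
  exact two_pow_le_NSub_of_eq (by omega) hh
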